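/- arXiv:2209.04971 — 7 statements merged into one kernel-verified Lean document; each statement's English description precedes it below -/
import Mathlib

section
/- Let x, p ∈ ℝⁿ with ‖x‖₂ = 1, let α ∈ ℝ, set W(α) = (α/2)(x p^T − p x^T) and Q(α) = (I + W(α))^{-1}(I − W(α)). Then Q(α)x = ( [(2 − α p^T x)² − α²‖p‖²]·x + 4α·p ) / ( 4 + α²‖p‖² − α²(p^T x)² ), where the denominator 4 + α²‖p‖² − α²(p^T x)² ≥ 4 > 0. -/
open Matrix
open scoped RealInnerProductSpace

noncomputable section

/-- If `W` is a real skew-symmetric matrix, then `1 + W` is invertible. -/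
theorem isUnit_det_one_add_of_transpose_eq_neg {ι : Type*} [Fintype ι] [DecidableEq ι]
    {W : Matrix ι ι ℝ} (hW : Wᵀ = -W) : IsUnit (1 + W).det := by
  rw [isUnit_iff_ne_zero]
  intro hdet
  obtain ⟨u, hu, h⟩ := Matrix.exists_mulVec_eq_zero_iff.mpr hdet
  refine hu (dotProduct_self_eq_zero.mp ?_)
  have hskew : u ⬝ᵥ W *ᵥ u = -(u ⬝ᵥ W *ᵥ u) := by
    conv_lhs => rw [dotProduct_mulVec, ← mulVec_transpose, hW, neg_mulVec, neg_dotProduct,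
      dotProduct_comm]
  have hsum : u ⬝ᵥ u + u ⬝ᵥ W *ᵥ u = 0 := by
    rw [← dotProduct_add, ← one_mulVec u, mulVec_mulVec, mul_one, ← add_mulVec, one_mulVec, h,
      dotProduct_zero]
  linarith

/-- Closed formula for the action on a unit vector `x` of the Cayley
transform `Q(α) = (I + W(α))⁻¹ (I − W(α))` of the skew-symmetric matrix
`W(α) = (α/2)(x pᵀ − p xᵀ)`, together with the lower bound `4` for the denominator. -/
theorem cayley_transform_formula {n : ℕ}
    (x p : EuclideanSpace ℝ (Fin n)) (hx : ‖x‖ = 1) (α : ℝ)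
    (W : Matrix (Fin n) (Fin n) ℝ)
    (hW : W = (α / 2) • (vecMulVec x p - vecMulVec p x)) :
    (4 : ℝ) ≤ 4 + α ^ 2 * ‖p‖ ^ 2 - α ^ 2 * ⟪p, x⟫ ^ 2 ∧
    Matrix.toEuclideanLin ((1 + W)⁻¹ * (1 - W)) x
      = (4 + α ^ 2 * ‖p‖ ^ 2 - α ^ 2 * ⟪p, x⟫ ^ 2)⁻¹ •
          ((((2 - α * ⟪p, x⟫) ^ 2 - α ^ 2 * ‖p‖ ^ 2) • x) + (4 * α) • p) := by
  have hD : (4 : ℝ) ≤ 4 + α ^ 2 * ‖p‖ ^ 2 - α ^ 2 * ⟪p, x⟫ ^ 2 := by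
    have hcs : ⟪p, x⟫ ^ 2 ≤ ‖p‖ ^ 2 := by
      have h := abs_real_inner_le_norm p x
      rw [hx, mul_one] at h
      exact sq_le_sq' (abs_le.mp h).1 (abs_le.mp h).2
    nlinarith [mul_le_mul_of_nonneg_left hcs (sq_nonneg α)]
  refine ⟨hD, ?_⟩
  have hskew : Wᵀ = -W := by
    rw [hW, transpose_smul, transpose_sub, transpose_vecMulVec, transpose_vecMulVec, ← smul_neg,
      neg_sub]
  have hxx : x.ofLp ⬝ᵥ x.ofLp = 1 := by
    have h := real_inner_self_eq_norm_sq x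
    rw [hx, EuclideanSpace.inner_eq_star_dotProduct] at h
    simpa using h
  have hpp : p.ofLp ⬝ᵥ p.ofLp = ‖p‖ ^ 2 := by
    rw [← real_inner_self_eq_norm_sq p, EuclideanSpace.inner_eq_star_dotProduct]
    simp
  have hxp : x.ofLp ⬝ᵥ p.ofLp = ⟪p, x⟫ := by
    rw [EuclideanSpace.inner_eq_star_dotProduct]
    simp
  have hpx : p.ofLp ⬝ᵥ x.ofLp = ⟪p, x⟫ := by rw [dotProduct_comm, hxp]
  have hWmul (y : Fin n → ℝ) :
      W *ᵥ y = (α / 2) • ((p.ofLp ⬝ᵥ y) • x.ofLp - (x.ofLp ⬝ᵥ y) • p.ofLp) := by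
    rw [hW, smul_mulVec, sub_mulVec, vecMulVec_mulVec, vecMulVec_mulVec]
    simp
  generalize ⟪p, x⟫ = c at *
  generalize ‖p‖ ^ 2 = N at *
  have hD0 : 4 + α ^ 2 * N - α ^ 2 * c ^ 2 ≠ 0 := by linarith
  have key : (1 - W) *ᵥ x.ofLp = (1 + W) *ᵥ ((4 + α ^ 2 * N - α ^ 2 * c ^ 2)⁻¹ •
      ((((2 - α * c) ^ 2 - α ^ 2 * N) • x.ofLp) + (4 * α) • p.ofLp)) := by
    rw [sub_mulVec, mulVec_smul, add_mulVec, one_mulVec, one_mulVec, hWmul, hWmul]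
    simp only [dotProduct_add, dotProduct_smul, hxx, hpp, hxp, hpx, smul_eq_mul]
    ext i
    simp only [Pi.add_apply, Pi.sub_apply, Pi.smul_apply, smul_eq_mul]
    field_simp
    ring
  ext i
  rw [toLpLin_apply, ← mulVec_mulVec, key, mulVec_mulVec,
    nonsing_inv_mul _ (isUnit_det_one_add_of_transpose_eq_neg hskew), one_mulVec]
  simp [mul_add]
end
end

section
/- Let x, p ∈ ℝⁿ with ‖x‖₂ = 1 and for α ∈ ℝ define x⁺(α) = ( [(2 − α p^T x)² − α²‖p‖²]·x + 4α·p ) / ( 4 + α²‖p‖² − α²(p^T x)² ). Then ‖x⁺(α)‖₂ = 1, and ‖x⁺(α) − x‖² = 4α²(‖p‖² − (p^T x)²) / ( 4 + α²‖p‖² − α²(p^T x)² ). In particular, for every α ∈ (0, 1], ‖x⁺(α) − x‖ ≤ ‖p‖. -/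
open scoped RealInnerProductSpace

noncomputable section

theorem norm_smul_add_smul_sq_of_norm_eq_one {E : Type*} [NormedAddCommGroup E]
    [InnerProductSpace ℝ E] {x : E} (hx : ‖x‖ = 1) (p : E) (a b : ℝ) :
    ‖a • x + b • p‖ ^ 2 = a ^ 2 + 2 * a * b * ⟪p, x⟫ + b ^ 2 * ‖p‖ ^ 2 := by
  rw [norm_add_sq_real, norm_smul, norm_smul, real_inner_smul_left, real_inner_smul_right,
    real_inner_comm, mul_pow, mul_pow, hx, Real.norm_eq_abs, Real.norm_eq_abs, sq_abs, sq_abs]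
  ring

/-- For a unit vector `x` and the Cayley-transform curve
`x⁺(α) = ([(2 − α pᵀx)² − α²‖p‖²] x + 4α p) / (4 + α²‖p‖² − α²(pᵀx)²)`:
`x⁺(α)` stays on the unit sphere, `‖x⁺(α) − x‖²` has the stated closed form, and
`‖x⁺(α) − x‖ ≤ ‖p‖` for every `α ∈ (0, 1]`. -/
theorem cayley_curve_on_sphere {n : ℕ}
    (x p : EuclideanSpace ℝ (Fin n)) (hx : ‖x‖ = 1)
    (xplus : ℝ → EuclideanSpace ℝ (Fin n))
    (hxplus : ∀ α : ℝ, xplus α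
      = (4 + α ^ 2 * ‖p‖ ^ 2 - α ^ 2 * ⟪p, x⟫ ^ 2)⁻¹ •
          ((((2 - α * ⟪p, x⟫) ^ 2 - α ^ 2 * ‖p‖ ^ 2) • x) + (4 * α) • p)) :
    (∀ α : ℝ, ‖xplus α‖ = 1) ∧
    (∀ α : ℝ, ‖xplus α - x‖ ^ 2
      = 4 * α ^ 2 * (‖p‖ ^ 2 - ⟪p, x⟫ ^ 2)
          / (4 + α ^ 2 * ‖p‖ ^ 2 - α ^ 2 * ⟪p, x⟫ ^ 2)) ∧
    (∀ α : ℝ, 0 < α → α ≤ 1 → ‖xplus α - x‖ ≤ ‖p‖) := by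
  have hcs : ⟪p, x⟫ ^ 2 ≤ ‖p‖ ^ 2 := by
    have h := abs_real_inner_le_norm p x
    rw [hx, mul_one] at h
    exact sq_le_sq' (abs_le.mp h).1 (abs_le.mp h).2
  have hD (α : ℝ) : 4 ≤ 4 + α ^ 2 * ‖p‖ ^ 2 - α ^ 2 * ⟪p, x⟫ ^ 2 := by
    have := mul_le_mul_of_nonneg_left hcs (sq_nonneg α)
    linarith
  have hD0 (α : ℝ) : 4 + α ^ 2 * ‖p‖ ^ 2 - α ^ 2 * ⟪p, x⟫ ^ 2 ≠ 0 :=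
    (lt_of_lt_of_le four_pos (hD α)).ne'
  have hdist (α : ℝ) : ‖xplus α - x‖ ^ 2
      = 4 * α ^ 2 * (‖p‖ ^ 2 - ⟪p, x⟫ ^ 2)
          / (4 + α ^ 2 * ‖p‖ ^ 2 - α ^ 2 * ⟪p, x⟫ ^ 2) := by
    have h0 := hD0 α
    have hsub (d a b : ℝ) : d • (a • x + b • p) - x = (d * a - 1) • x + (d * b) • p := by
      module
    rw [hxplus, hsub, norm_smul_add_smul_sq_of_norm_eq_one hx]
    field_simp
    ring
  refine ⟨fun α => ?_, hdist, fun α h0 h1 => ?_⟩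
  · have hd := hD0 α
    have hsq : ‖xplus α‖ ^ 2 = 1 := by
      rw [hxplus, norm_smul, mul_pow, norm_smul_add_smul_sq_of_norm_eq_one hx,
        Real.norm_eq_abs, sq_abs]
      field_simp
      ring
    exact (pow_eq_one_iff_of_nonneg (norm_nonneg _) two_ne_zero).mp hsq
  · refine (sq_le_sq₀ (norm_nonneg _) (norm_nonneg _)).mp ?_
    rw [hdist, div_le_iff₀ (by linarith [hD α])]
    have hα : α ^ 2 ≤ 1 := pow_le_one₀ h0.le h1
    calc 4 * α ^ 2 * (‖p‖ ^ 2 - ⟪p, x⟫ ^ 2) ≤ 4 * 1 * ‖p‖ ^ 2 := by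
          gcongr
          linarith [sq_nonneg ⟪p, x⟫]
      _ ≤ ‖p‖ ^ 2 * (4 + α ^ 2 * ‖p‖ ^ 2 - α ^ 2 * ⟪p, x⟫ ^ 2) := by
          linarith [mul_le_mul_of_nonneg_left (hD α) (sq_nonneg ‖p‖)]
end
end

section
/- Let x, p ∈ ℝⁿ with ‖x‖₂ = 1 and for α ∈ ℝ define x⁺(α) = ( [(2 − α p^T x)² − α²‖p‖²]·x + 4α·p ) / ( 4 + α²‖p‖² − α²(p^T x)² ). Then the curve α ↦ x⁺(α) is differentiable at α = 0 with derivative (x⁺)'(0) = p − (x^T p)·x. Consequently, if f : ℝⁿ → ℝ is differentiable at x and ∇f(x)^T x = 0, then the function α ↦ f(x⁺(α)) has derivative at α = 0 equal to ∇f(x)^T p. -/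
open scoped RealInnerProductSpace

noncomputable section

/-- The Cayley-transform curve
`x⁺(α) = ([(2 − α pᵀx)² − α²‖p‖²] x + 4α p) / (4 + α²‖p‖² − α²(pᵀx)²)` through the unit
vector `x` is differentiable at `α = 0` with derivative `p − (xᵀp) x`; consequently, if
`f` is differentiable at `x` and `∇f(x)ᵀ x = 0`, then `α ↦ f(x⁺(α))` has derivative
`∇f(x)ᵀ p` at `α = 0`. -/
theorem cayley_curve_derivative_at_zero {n : ℕ}
    (x p : EuclideanSpace ℝ (Fin n)) (hx : ‖x‖ = 1)
    (xplus : ℝ → EuclideanSpace ℝ (Fin n))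
    (hxplus : ∀ α : ℝ, xplus α
      = (4 + α ^ 2 * ‖p‖ ^ 2 - α ^ 2 * ⟪p, x⟫ ^ 2)⁻¹ •
          ((((2 - α * ⟪p, x⟫) ^ 2 - α ^ 2 * ‖p‖ ^ 2) • x) + (4 * α) • p)) :
    HasDerivAt xplus (p - ⟪x, p⟫ • x) 0 ∧
    ∀ f : EuclideanSpace ℝ (Fin n) → ℝ, DifferentiableAt ℝ f x →
      ⟪gradient f x, x⟫ = 0 →
      HasDerivAt (fun α => f (xplus α)) ⟪gradient f x, p⟫ 0 := by
  have hcurve : HasDerivAt xplus (p - ⟪x, p⟫ • x) 0 := by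
    have hden : HasDerivAt (fun α : ℝ => 4 + α ^ 2 * ‖p‖ ^ 2 - α ^ 2 * ⟪p, x⟫ ^ 2) 0 0 := by
      have hsq : HasDerivAt (fun α : ℝ => α ^ 2) 0 0 := by
        simpa using hasDerivAt_pow 2 (0 : ℝ)
      simpa using ((hsq.mul_const (‖p‖ ^ 2)).const_add 4).fun_sub (hsq.mul_const (⟪p, x⟫ ^ 2))
    have hcoef : HasDerivAt (fun α : ℝ => (2 - α * ⟪p, x⟫) ^ 2 - α ^ 2 * ‖p‖ ^ 2)
        (-4 * ⟪p, x⟫) 0 := by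
      have hlin := (((hasDerivAt_id' (0 : ℝ)).mul_const ⟪p, x⟫).const_sub 2).fun_pow 2
      have hsq := (hasDerivAt_pow 2 (0 : ℝ)).mul_const (‖p‖ ^ 2)
      refine (hlin.fun_sub hsq).congr_deriv ?_
      norm_num
    have hnum := (hcoef.smul_const x).fun_add
      (((hasDerivAt_id' (0 : ℝ)).const_mul 4).smul_const p)
    rw [funext hxplus]
    refine ((hden.fun_inv (by norm_num)).fun_smul hnum).congr_deriv ?_
    rw [real_inner_comm x p]
    norm_num
    module
  refine ⟨hcurve, fun f hf hgrad => ?_⟩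
  have hzero : xplus 0 = x := by
    rw [hxplus]
    norm_num [smul_smul]
  have hf' := hf.hasGradientAt.hasFDerivAt
  rw [← hzero] at hf'
  refine (hf'.comp_hasDerivAt (0 : ℝ) hcurve).congr_deriv ?_
  rw [hzero]
  rw [InnerProductSpace.toDual_apply_apply, inner_sub_right, inner_smul_right, hgrad, mul_zero,
    sub_zero]
end
end

section
/- Let x, p, g ∈ ℝⁿ with ‖x‖₂ = 1 and g^T x = 0, and define x⁺(1) = ( [(2 − p^T x)² − ‖p‖²]·x + 4·p ) / ( 4 + ‖p‖² − (p^T x)² ). Then g^T( x⁺(1) − x − p ) = −(g^T p)·( ‖p‖² − (p^T x)² ) / ( 4 + ‖p‖² − (p^T x)² ), and hence |g^T( x⁺(1) − x − p )| ≤ (|g^T p| / 4)·‖p‖² ≤ (‖g‖/4)·‖p‖³. -/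
open scoped RealInnerProductSpace

noncomputable section

/-- For unit `x`, `g` orthogonal to `x`, and
`x⁺(1) = ([(2 − pᵀx)² − ‖p‖²] x + 4 p) / (4 + ‖p‖² − (pᵀx)²)`, one has
`gᵀ(x⁺(1) − x − p) = −(gᵀp)(‖p‖² − (pᵀx)²)/(4 + ‖p‖² − (pᵀx)²)`, hence
`|gᵀ(x⁺(1) − x − p)| ≤ (|gᵀp|/4)‖p‖² ≤ (‖g‖/4)‖p‖³`. -/
theorem cayley_step_inner_estimate {n : ℕ}
    (x p g : EuclideanSpace ℝ (Fin n)) (hx : ‖x‖ = 1) (hg : ⟪g, x⟫ = 0)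
    (xplus1 : EuclideanSpace ℝ (Fin n))
    (hxplus1 : xplus1
      = (4 + ‖p‖ ^ 2 - ⟪p, x⟫ ^ 2)⁻¹ •
          ((((2 - ⟪p, x⟫) ^ 2 - ‖p‖ ^ 2) • x) + (4 : ℝ) • p)) :
    ⟪g, xplus1 - x - p⟫
        = -(⟪g, p⟫ * (‖p‖ ^ 2 - ⟪p, x⟫ ^ 2) / (4 + ‖p‖ ^ 2 - ⟪p, x⟫ ^ 2)) ∧
    |⟪g, xplus1 - x - p⟫| ≤ |⟪g, p⟫| / 4 * ‖p‖ ^ 2 ∧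
    |⟪g, p⟫| / 4 * ‖p‖ ^ 2 ≤ ‖g‖ / 4 * ‖p‖ ^ 3 := by
  have hpx : ⟪p, x⟫ ^ 2 ≤ ‖p‖ ^ 2 := by
    have h := abs_real_inner_le_norm p x
    rw [hx, mul_one] at h
    exact sq_le_sq' (abs_le.mp h).1 (abs_le.mp h).2
  have hden : 4 ≤ 4 + ‖p‖ ^ 2 - ⟪p, x⟫ ^ 2 := by linarith
  have hden_ne : 4 + ‖p‖ ^ 2 - ⟪p, x⟫ ^ 2 ≠ 0 := by linarith
  have hinner : ⟪g, xplus1 - x - p⟫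
      = -(⟪g, p⟫ * (‖p‖ ^ 2 - ⟪p, x⟫ ^ 2) / (4 + ‖p‖ ^ 2 - ⟪p, x⟫ ^ 2)) := by
    rw [hxplus1, inner_sub_right, inner_sub_right, real_inner_smul_right, inner_add_right,
      real_inner_smul_right, real_inner_smul_right, hg]
    field_simp
    ring
  refine ⟨hinner, ?_, ?_⟩
  · rw [hinner, abs_neg, abs_div, abs_mul, abs_of_nonneg (sub_nonneg.mpr hpx),
      abs_of_pos (show 0 < 4 + ‖p‖ ^ 2 - ⟪p, x⟫ ^ 2 by linarith), div_mul_eq_mul_div]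
    gcongr
    exact sub_le_self _ (sq_nonneg _)
  · calc |⟪g, p⟫| / 4 * ‖p‖ ^ 2 ≤ ‖g‖ * ‖p‖ / 4 * ‖p‖ ^ 2 := by
          gcongr
          exact abs_real_inner_le_norm g p
      _ = ‖g‖ / 4 * ‖p‖ ^ 3 := by ring
end
end

section
/- Let f ∈ ℝ, g ∈ ℝⁿ, B ∈ ℝ^{n×n} a symmetric matrix, σ > 0, and define the cubic model m(p) = f + g^T p + (1/2)·p^T B p + (σ/3)·‖p‖³ for p ∈ ℝⁿ. Suppose p* ∈ ℝⁿ satisfies m(p*) ≤ m(−τ g) for every τ ≥ 0 (i.e. m(p*) is at most the minimum of m along the steepest-descent ray, in particular at most the value at the Cauchy point). Then f − m(p*) ≥ (‖g‖ / (6√2)) · min( ‖g‖ / (1 + ‖B‖), (1/2)·√(‖g‖/σ) ). -/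
open scoped RealInnerProductSpace

noncomputable section

/-- Cauchy-point decrease of the cubic regularization model
`m(p) = f + gᵀp + ½ pᵀBp + (σ/3)‖p‖³`: if `m(p*)` is at most the value of `m` everywhere
along the steepest-descent ray `{−τ g : τ ≥ 0}` (in particular at the Cauchy point), then
`f − m(p*) ≥ (‖g‖/(6√2)) · min(‖g‖/(1+‖B‖), ½√(‖g‖/σ))`. -/
theorem cubic_model_cauchy_decrease {n : ℕ}
    (f σ : ℝ) (hσ : 0 < σ) (g : EuclideanSpace ℝ (Fin n))
    (B : EuclideanSpace ℝ (Fin n) →L[ℝ] EuclideanSpace ℝ (Fin n))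
    (hB : ∀ u v : EuclideanSpace ℝ (Fin n), ⟪B u, v⟫ = ⟪u, B v⟫)
    (m : EuclideanSpace ℝ (Fin n) → ℝ)
    (hm : ∀ p : EuclideanSpace ℝ (Fin n),
      m p = f + ⟪g, p⟫ + (1 / 2) * ⟪p, B p⟫ + (σ / 3) * ‖p‖ ^ 3)
    (pstar : EuclideanSpace ℝ (Fin n))
    (hpstar : ∀ τ : ℝ, 0 ≤ τ → m pstar ≤ m (-(τ • g))) :
    f - m pstar ≥ ‖g‖ / (6 * Real.sqrt 2) *
      min (‖g‖ / (1 + ‖B‖)) (1 / 2 * Real.sqrt (‖g‖ / σ)) := by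
  set s : ℝ := min (‖g‖ / (1 + ‖B‖)) (1 / 2 * Real.sqrt (‖g‖ / σ))
  have hs0 : 0 ≤ s := by positivity
  have hb : 0 < 1 + ‖B‖ := by positivity
  have hsB : s * (1 + ‖B‖) ≤ ‖g‖ := (le_div_iff₀ hb).mp (min_le_left _ _)
  have hsσ : 4 * (σ * s ^ 2) ≤ ‖g‖ := by
    have h : s ^ 2 ≤ (1 / 2 * Real.sqrt (‖g‖ / σ)) ^ 2 :=
      pow_le_pow_left₀ hs0 (min_le_right _ _) 2
    rw [mul_pow, Real.sq_sqrt (by positivity)] at h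
    have h' := mul_le_mul_of_nonneg_left h hσ.le
    have e : σ * ((1 / 2) ^ 2 * (‖g‖ / σ)) = ‖g‖ / 4 := by field_simp; ring
    linarith
  obtain ⟨τ, hτ, hτs⟩ : ∃ τ : ℝ, 0 ≤ τ ∧ τ * ‖g‖ = s := by
    rcases (norm_nonneg g).eq_or_lt with h | h
    · exact ⟨0, le_rfl, by nlinarith [norm_nonneg B]⟩
    · exact ⟨s / ‖g‖, by positivity, div_mul_cancel₀ _ h.ne'⟩
  have hmodel := hpstar τ hτ
  have hnorm : ‖-(τ • g)‖ = s := by rw [norm_neg, norm_smul, Real.norm_of_nonneg hτ, hτs]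
  have hlin : ⟪g, -(τ • g)⟫ = -(‖g‖ * s) := by
    rw [inner_neg_right, real_inner_smul_right, real_inner_self_eq_norm_sq, ← hτs]
    ring
  have hquad : ⟪-(τ • g), B (-(τ • g))⟫ ≤ ‖B‖ * s ^ 2 :=
    calc ⟪-(τ • g), B (-(τ • g))⟫ ≤ ‖-(τ • g)‖ * ‖B (-(τ • g))‖ := real_inner_le_norm _ _
      _ ≤ ‖-(τ • g)‖ * (‖B‖ * ‖-(τ • g)‖) := by gcongr; exact B.le_opNorm _
      _ = ‖B‖ * s ^ 2 := by rw [hnorm]; ring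
  rw [hm (-(τ • g)), hlin, hnorm] at hmodel
  have hB' : ‖B‖ * s ^ 2 ≤ ‖g‖ * s := by nlinarith
  have hσ' : 4 * (σ * s ^ 3) ≤ ‖g‖ * s := by nlinarith
  have hcoef : ‖g‖ / (6 * Real.sqrt 2) ≤ ‖g‖ / 6 := by
    gcongr
    linarith [Real.one_le_sqrt.mpr (one_le_two : (1 : ℝ) ≤ 2)]
  have hgs : 0 ≤ ‖g‖ * s := by positivity
  have := mul_le_mul_of_nonneg_right hcoef hs0
  linarith
end
end

section
/- Let f ∈ ℝ, g ∈ ℝⁿ, B ∈ ℝ^{n×n} a symmetric matrix, σ > 0, and define the cubic model m(p) = f + g^T p + (1/2)·p^T B p + (σ/3)·‖p‖³ for p ∈ ℝⁿ. If p ∈ ℝⁿ satisfies m(p) ≤ m(0) = f, then ‖p‖ ≤ (3/σ)·max( ‖B‖, √(σ‖g‖) ). -/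
open scoped RealInnerProductSpace

noncomputable section

/-- Bound on the step of the cubic regularization model
`m(p) = f + gᵀp + ½ pᵀBp + (σ/3)‖p‖³`: if `m(p) ≤ m(0) = f`, then
`‖p‖ ≤ (3/σ) max(‖B‖, √(σ‖g‖))`. -/
theorem cubic_model_step_bound {n : ℕ}
    (f σ : ℝ) (hσ : 0 < σ) (g : EuclideanSpace ℝ (Fin n))
    (B : EuclideanSpace ℝ (Fin n) →L[ℝ] EuclideanSpace ℝ (Fin n))
    (hB : ∀ u v : EuclideanSpace ℝ (Fin n), ⟪B u, v⟫ = ⟪u, B v⟫)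
    (m : EuclideanSpace ℝ (Fin n) → ℝ)
    (hm : ∀ q : EuclideanSpace ℝ (Fin n),
      m q = f + ⟪g, q⟫ + (1 / 2) * ⟪q, B q⟫ + (σ / 3) * ‖q‖ ^ 3)
    (p : EuclideanSpace ℝ (Fin n)) (hp : m p ≤ m 0) :
    ‖p‖ ≤ 3 / σ * max ‖B‖ (Real.sqrt (σ * ‖g‖)) := by
  have h0 : m 0 = f := by simp [hm]
  rw [h0, hm] at hp
  have hg : -(‖g‖ * ‖p‖) ≤ ⟪g, p⟫ := (abs_le.mp (abs_real_inner_le_norm g p)).1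
  have hBp : -(‖B‖ * ‖p‖ ^ 2) ≤ ⟪p, B p⟫ := by
    have h₁ := (abs_le.mp (abs_real_inner_le_norm p (B p))).1
    have h₂ := mul_le_mul_of_nonneg_left (B.le_opNorm p) (norm_nonneg p)
    linarith
  set M := max ‖B‖ (Real.sqrt (σ * ‖g‖)) with hM
  have hBM : ‖B‖ ≤ M := le_max_left _ _
  have hM0 : 0 ≤ M := (norm_nonneg B).trans hBM
  have hgM : σ * ‖g‖ ≤ M ^ 2 := (Real.sqrt_le_left hM0).mp (le_max_right _ _)
  by_contra! hlt
  rw [div_mul_eq_mul_div, div_lt_iff₀ hσ] at hlt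
  have ht : 0 < ‖p‖ := by
    refine pos_of_mul_pos_left (b := σ) ?_ hσ.le
    linarith
  have hquad : σ / 3 * ‖p‖ ^ 2 ≤ ‖g‖ + ‖B‖ * ‖p‖ / 2 := by
    refine le_of_mul_le_mul_right ?_ ht
    linarith
  have hσquad := mul_le_mul_of_nonneg_left hquad hσ.le
  have hBσ : ‖B‖ * (‖p‖ * σ) ≤ M * (‖p‖ * σ) := by gcongr
  have hsq : 0 < (‖p‖ * σ - 3 * M) * (2 * (‖p‖ * σ) + 3 * M) :=
    mul_pos (by linarith) (by positivity)
  linarith [sq_nonneg M]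
end
end

section
/- Let S ⊆ ℝⁿ, let g : S → ℝⁿ be uniformly continuous on S, let (x_k)_{k∈ℕ} be a sequence in S, and let (f_k)_{k∈ℕ} be a nonincreasing sequence of reals that is bounded below. Assume: (i) liminf_{k→∞} ‖g(x_k)‖ = 0, and (ii) for every ε > 0 there exist c > 0 and K ∈ ℕ such that for every k ≥ K with ‖g(x_k)‖ ≥ ε one has f_k − f_{k+1} ≥ c·‖x_{k+1} − x_k‖. Then lim_{k→∞} ‖g(x_k)‖ = 0. -/
open Filter

noncomputable section

/-- If each step of `x` between `k` and `l` is controlled by the decrease of `f`, then so is the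
displacement from `x k` to `x l`. -/
theorem mul_dist_le_sub_of_step {E : Type*} [SeminormedAddCommGroup E] {x : ℕ → E} {f : ℕ → ℝ}
    {c : ℝ} (hc : 0 ≤ c) {k l : ℕ} (hkl : k ≤ l)
    (h : ∀ j, k ≤ j → j < l → c * ‖x (j + 1) - x j‖ ≤ f j - f (j + 1)) :
    c * dist (x l) (x k) ≤ f k - f l := by
  induction l, hkl using Nat.le_induction with
  | base => simp
  | succ l hkl ih =>
    have hstep := h l hkl l.lt_succ_self
    have hprev := ih fun j hj hjl => h j hj (hjl.trans l.lt_succ_self)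
    rw [← dist_eq_norm] at hstep
    have htri := mul_le_mul_of_nonneg_left (dist_triangle (x (l + 1)) (x l) (x k)) hc
    linarith

/-- The values of a uniformly continuous map along a sequence whose steps are eventually controlled
by the decrease of a convergent sequence form a Cauchy sequence. -/
theorem cauchySeq_comp_of_step_le_sub {E F : Type*} [SeminormedAddCommGroup E]
    [PseudoMetricSpace F] {S : Set E} {g : E → F} (hg : UniformContinuousOn g S) {x : ℕ → E}
    (hxS : ∀ k, x k ∈ S) {f : ℕ → ℝ} (hf : CauchySeq f) {c : ℝ} (hc : 0 < c) {K : ℕ}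
    (h : ∀ k ≥ K, c * ‖x (k + 1) - x k‖ ≤ f k - f (k + 1)) :
    CauchySeq fun k => g (x k) := by
  rw [Metric.cauchySeq_iff']
  intro ε hε
  obtain ⟨δ, hδ, hgδ⟩ := Metric.uniformContinuousOn_iff.1 hg ε hε
  obtain ⟨N, hN⟩ := Metric.cauchySeq_iff.1 hf (c * δ) (mul_pos hc hδ)
  refine ⟨max N K, fun l hl => hgδ _ (hxS _) _ (hxS _) ?_⟩
  have hdist := mul_dist_le_sub_of_step hc.le hl
    fun j hj _ => h j ((le_max_right N K).trans hj)
  have hfN := hN (max N K) (le_max_left N K) l ((le_max_left N K).trans hl)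
  rw [Real.dist_eq] at hfN
  exact lt_of_mul_lt_mul_left (hdist.trans_lt ((le_abs_self _).trans_lt hfN)) hc.le

/-- Abstract global convergence of the adaptive cubic regularization
iteration: if `g` is uniformly continuous on `S`, the iterates `x k` lie in `S`, the
objective values `f k` are nonincreasing and bounded below,
`liminf ‖g (x k)‖ = 0`, and for every `ε > 0` there are `c > 0` and `K` such that
`f k − f (k+1) ≥ c ‖x (k+1) − x k‖` whenever `k ≥ K` and `‖g (x k)‖ ≥ ε`, then
`‖g (x k)‖ → 0`. -/
theorem gradient_norm_tendsto_zero {n : ℕ}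
    (S : Set (EuclideanSpace ℝ (Fin n)))
    (g : EuclideanSpace ℝ (Fin n) → EuclideanSpace ℝ (Fin n))
    (hg : UniformContinuousOn g S)
    (x : ℕ → EuclideanSpace ℝ (Fin n)) (hxS : ∀ k, x k ∈ S)
    (f : ℕ → ℝ) (hf_mono : ∀ k, f (k + 1) ≤ f k) (hf_bdd : BddBelow (Set.range f))
    (h_liminf : Filter.liminf (fun k => ‖g (x k)‖) Filter.atTop = 0)
    (h_decrease : ∀ ε > (0 : ℝ), ∃ c > (0 : ℝ), ∃ K : ℕ, ∀ k ≥ K,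
      ε ≤ ‖g (x k)‖ → f k - f (k + 1) ≥ c * ‖x (k + 1) - x k‖) :
    Filter.Tendsto (fun k => ‖g (x k)‖) Filter.atTop (nhds 0) := by
  have hf : CauchySeq f :=
    (tendsto_atTop_ciInf (antitone_nat_of_succ_le hf_mono) hf_bdd).cauchySeq
  have h_freq : ∀ ε > (0 : ℝ), ∃ᶠ k in atTop, ‖g (x k)‖ < ε := by
    intro ε hε h_large
    simp only [not_lt] at h_large
    obtain ⟨c, hc, K, hK⟩ := h_decrease ε hε
    obtain ⟨M, hM⟩ := eventually_atTop.1 h_large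
    obtain ⟨y, hy⟩ := cauchySeq_tendsto_of_complete <|
      cauchySeq_comp_of_step_le_sub hg hxS hf hc (K := max K M) fun k hk =>
        hK k ((le_max_left K M).trans hk) (hM k ((le_max_right K M).trans hk))
    have hy_norm : ε ≤ ‖y‖ := ge_of_tendsto hy.norm h_large
    rw [hy.norm.liminf_eq] at h_liminf
    linarith
  rw [Metric.tendsto_atTop]
  intro ε hε
  obtain ⟨δ, hδ, hgδ⟩ := Metric.uniformContinuousOn_iff.1 hg (ε / 2) (half_pos hε)
  obtain ⟨c, hc, K, hK⟩ := h_decrease (ε / 2) (half_pos hε)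
  obtain ⟨N, hN⟩ := Metric.cauchySeq_iff.1 hf (c * δ) (mul_pos hc hδ)
  refine ⟨max N K, fun k hk => ?_⟩
  rw [dist_zero_right, norm_norm]
  classical
  have h_exists : ∃ l, k ≤ l ∧ ‖g (x l)‖ < ε / 2 :=
    frequently_atTop.1 (h_freq (ε / 2) (half_pos hε)) k
  obtain ⟨hkl, hl⟩ := Nat.find_spec h_exists
  have h_min := fun j => Nat.find_min h_exists (m := j)
  generalize Nat.find h_exists = l at hkl hl h_min
  have hdist := mul_dist_le_sub_of_step hc.le hkl fun j hj hjl =>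
    hK j ((le_max_right N K).trans (hk.trans hj))
      (not_lt.1 fun hlt => h_min j hjl ⟨hj, hlt⟩)
  have hNk : N ≤ k := (le_max_left N K).trans hk
  have hfN := hN k hNk l (hNk.trans hkl)
  rw [Real.dist_eq] at hfN
  have hδ_dist : dist (x l) (x k) < δ :=
    lt_of_mul_lt_mul_left (hdist.trans_lt ((le_abs_self _).trans_lt hfN)) hc.le
  have hg_dist := hgδ _ (hxS l) _ (hxS k) hδ_dist
  rw [dist_comm, dist_eq_norm] at hg_dist
  linarith [norm_sub_norm_le (g (x k)) (g (x l))]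
end
end
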